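/- Let T > 0 and let g be a Preisach density with Lipschitz bound μ ∈ L¹(0,∞). Define G(r,v) := ∫₀^v v'·(∂g/∂v)(r,v') dv' (the partial derivative ∂g/∂v existing a.e. since g(r,·) is Lipschitz). Let q : [0,T] → ℝ be absolutely continuous, for each r > 0 let ξ_r be the solution of the play variational inequality with threshold r and input q, and set P(t) := ∫₀^∞ g(r, ξ_r(t)) dr and U(t) := ∫₀^∞ G(r, ξ_r(t)) dr. Then P and U are absolutely continuous on [0,T] and for a.e. t ∈ (0,T) one has q(t)·P'(t) − U'(t) ≥ 0. -/

import Mathlib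

open MeasureTheory Set

/-- `q` is absolutely continuous on `[0,T]` with a.e. derivative `q'`,
encoded via the fundamental theorem of calculus. -/
def IsACOn (T : ℝ) (q q' : ℝ → ℝ) : Prop :=
  IntegrableOn q' (Icc 0 T) ∧ ∀ t ∈ Icc 0 T, q t = q 0 + ∫ τ in (0:ℝ)..t, q' τ

/-- `ξ` (with a.e. derivative `ξ'`) solves the play variational inequality
with threshold `r` and input `q` on `[0,T]`:
(i) `|q - ξ| ≤ r` on `[0,T]`, (ii) `ξ'(t)(q(t) - ξ(t) - r z) ≥ 0` for a.e. `t`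
and all `z ∈ [-1,1]`, (iii) `ξ(0) = max{q(0) - r, min{0, q(0) + r}}`. -/
def IsPlaySol (T r : ℝ) (q ξ ξ' : ℝ → ℝ) : Prop :=
  IsACOn T ξ ξ' ∧
  (∀ t ∈ Icc 0 T, |q t - ξ t| ≤ r) ∧
  (∀ᵐ t ∂(volume.restrict (Ioo 0 T)),
    ∀ z ∈ Icc (-1:ℝ) 1, ξ' t * (q t - ξ t - r * z) ≥ 0) ∧
  ξ 0 = max (q 0 - r) (min 0 (q 0 + r))

/-- `g : (0,∞) × ℝ → ℝ` is a Preisach density with Lipschitz bound `μ`: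
`g` is measurable, `μ ∈ L¹(0,∞)`, and for a.e. `r > 0` one has `g(r,0) = 0`
and `v ↦ g(r,v)` is nondecreasing and Lipschitz with constant `μ(r) ≥ 0`. -/
def IsPreisachDensity (g : ℝ → ℝ → ℝ) (μ : ℝ → ℝ) : Prop :=
  Measurable (Function.uncurry g) ∧
  IntegrableOn μ (Ioi 0) ∧
  ∀ᵐ r ∂(volume.restrict (Ioi (0:ℝ))),
    g r 0 = 0 ∧ 0 ≤ μ r ∧ Monotone (g r) ∧
      LipschitzWith (Real.toNNReal (μ r)) (g r)

namespace IsACOn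

variable {T : ℝ} {f f' h h' : ℝ → ℝ}

lemma neg (hf : IsACOn T f f') : IsACOn T (fun t ↦ -f t) (fun t ↦ -f' t) := by
  refine ⟨hf.1.neg, fun t ht ↦ ?_⟩
  rw [intervalIntegral.integral_neg]
  linear_combination -(hf.2 t ht)

lemma intervalIntegrable (hf : IsACOn T f f') {s t : ℝ} (hs : s ∈ Icc 0 T) (ht : t ∈ Icc 0 T) :
    IntervalIntegrable f' volume s t :=
  (hf.1.mono_set (ordConnected_Icc.uIcc_subset hs ht)).intervalIntegrable

lemma sub (hf : IsACOn T f f') (hh : IsACOn T h h') :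
    IsACOn T (fun t ↦ f t - h t) (fun t ↦ f' t - h' t) := by
  refine ⟨hf.1.sub hh.1, fun t ht ↦ ?_⟩
  have h0 : (0 : ℝ) ∈ Icc 0 T := ⟨le_rfl, ht.1.trans ht.2⟩
  rw [intervalIntegral.integral_sub (hf.intervalIntegrable h0 ht) (hh.intervalIntegrable h0 ht)]
  linear_combination hf.2 t ht - hh.2 t ht

lemma sub_eq_integral (hf : IsACOn T f f') {s t : ℝ} (hs : s ∈ Icc 0 T) (ht : t ∈ Icc 0 T) :
    f t - f s = ∫ τ in s..t, f' τ := by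
  have h0 : (0 : ℝ) ∈ Icc 0 T := ⟨le_rfl, ht.1.trans ht.2⟩
  rw [← intervalIntegral.integral_interval_sub_left (hf.intervalIntegrable h0 ht)
    (hf.intervalIntegrable h0 hs), hf.2 t ht, hf.2 s hs]
  ring

lemma continuousOn (hf : IsACOn T f f') : ContinuousOn f (Icc 0 T) := by
  rcases lt_or_ge T 0 with hT | hT
  · simp [Icc_eq_empty_of_lt hT]
  have hint := hf.1
  rw [← uIcc_of_le hT] at hint ⊢
  refine (continuousOn_const.add
    (intervalIntegral.continuousOn_primitive_interval hint)).congr fun t ht ↦ hf.2 t ?_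
  rwa [uIcc_of_le hT] at ht

/-- A function starting below a level `c` and with nonpositive derivative above that level
stays below it. -/
lemma le_of_deriv_nonpos_above (hf : IsACOn T f f') {s t c : ℝ} (hs : 0 ≤ s) (hst : s ≤ t)
    (ht : t ≤ T) (hsc : f s ≤ c)
    (h : ∀ᵐ τ ∂(volume.restrict (Ioo 0 T)), τ ∈ Ioo s t → c < f τ → f' τ ≤ 0) : f t ≤ c := by
  by_contra! hct
  have hcont : ContinuousOn f (Icc s t) := hf.continuousOn.mono (Icc_subset_Icc hs ht)
  have hclosed : IsClosed (Icc s t ∩ f ⁻¹' Iic c) :=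
    hcont.preimage_isClosed_of_isClosed isClosed_Icc isClosed_Iic
  have hcomp : IsCompact (Icc s t ∩ f ⁻¹' Iic c) :=
    isCompact_Icc.of_isClosed_subset hclosed inter_subset_left
  obtain ⟨a, ⟨⟨hsa, hat⟩, hac⟩, hmax⟩ := hcomp.exists_isGreatest ⟨s, ⟨le_rfl, hst⟩, hsc⟩
  have hac : f a ≤ c := hac
  have habove : ∀ τ ∈ Ioo a t, c < f τ := by
    intro τ hτ
    by_contra! hle
    exact absurd (hmax ⟨⟨hsa.trans hτ.1.le, hτ.2.le⟩, hle⟩) (not_le.mpr hτ.1)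
  have hincr := hf.sub_eq_integral (s := a) (t := t) ⟨hs.trans hsa, hat.trans ht⟩
    ⟨hs.trans hst, ht⟩
  have hnonpos : ∫ τ in a..t, f' τ ≤ 0 := by
    rw [intervalIntegral.integral_of_le hat, integral_Ioc_eq_integral_Ioo]
    refine integral_nonpos_of_ae ?_
    have hsub : Ioo a t ⊆ Ioo 0 T := Ioo_subset_Ioo (hs.trans hsa) ht
    filter_upwards [ae_restrict_of_ae_restrict_of_subset hsub h,
      ae_restrict_mem measurableSet_Ioo] with τ h1 h2
    exact h1 ⟨hsa.trans_lt h2.1, h2.2⟩ (habove τ h2)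
  linarith

end IsACOn

namespace IsPlaySol

variable {T r r₁ r₂ : ℝ} {q ξ ξ' ξ₁ ξ₁' ξ₂ ξ₂' : ℝ → ℝ}

lemma deriv_nonpos (hξ : IsPlaySol T r q ξ ξ') :
    ∀ᵐ t ∂(volume.restrict (Ioo 0 T)), q t - ξ t < r → ξ' t ≤ 0 := by
  filter_upwards [hξ.2.2.1] with t ht hlt
  have := ht 1 (by norm_num)
  by_contra! hpos
  nlinarith

lemma deriv_nonneg (hξ : IsPlaySol T r q ξ ξ') :
    ∀ᵐ t ∂(volume.restrict (Ioo 0 T)), -r < q t - ξ t → 0 ≤ ξ' t := by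
  filter_upwards [hξ.2.2.1] with t ht hlt
  have := ht (-1) (by norm_num)
  by_contra! hneg
  nlinarith

lemma le_max (hξ : IsPlaySol T r q ξ ξ') {s t m : ℝ} (hs : 0 ≤ s) (hst : s ≤ t) (ht : t ≤ T)
    (hq : ∀ τ ∈ Icc s t, q τ ≤ m) : ξ t ≤ max (ξ s) (m - r) := by
  refine hξ.1.le_of_deriv_nonpos_above hs hst ht (le_max_left _ _) ?_
  filter_upwards [hξ.deriv_nonpos] with τ h1 h2 h3
  refine h1 ?_
  have := hq τ (Ioo_subset_Icc_self h2)
  have := (le_max_right (ξ s) (m - r)).trans_lt h3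
  linarith

lemma min_le (hξ : IsPlaySol T r q ξ ξ') {s t m : ℝ} (hs : 0 ≤ s) (hst : s ≤ t) (ht : t ≤ T)
    (hq : ∀ τ ∈ Icc s t, m ≤ q τ) : min (ξ s) (m + r) ≤ ξ t := by
  rw [← neg_le_neg_iff]
  refine hξ.1.neg.le_of_deriv_nonpos_above hs hst ht (neg_le_neg (min_le_left _ _)) ?_
  filter_upwards [hξ.deriv_nonneg] with τ h1 h2 h3
  rw [neg_nonpos]
  refine h1 ?_
  have := hq τ (Ioo_subset_Icc_self h2)
  have := (neg_lt_neg_iff.mp h3).trans_le (min_le_right (ξ s) (m + r))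
  linarith

lemma sub_le (h₁ : IsPlaySol T r₁ q ξ₁ ξ₁') (h₂ : IsPlaySol T r₂ q ξ₂ ξ₂') {t : ℝ}
    (ht : t ∈ Icc 0 T) : ξ₁ t - ξ₂ t ≤ |r₁ - r₂| := by
  have hr₁ := le_abs_self (r₁ - r₂)
  have hr₂ := neg_abs_le (r₁ - r₂)
  refine (h₁.1.sub h₂.1).le_of_deriv_nonpos_above le_rfl ht.1 ht.2 ?_ ?_
  · rw [h₁.2.2.2, h₂.2.2.2]
    grind
  · filter_upwards [h₁.deriv_nonpos, h₂.deriv_nonneg, ae_restrict_mem measurableSet_Ioo]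
      with τ h3 h4 hτ _ h5
    have h6 := abs_le.mp (h₁.2.1 τ (Ioo_subset_Icc_self hτ))
    have h7 := abs_le.mp (h₂.2.1 τ (Ioo_subset_Icc_self hτ))
    have h8 := h3 (by linarith)
    have h9 := h4 (by linarith)
    linarith

lemma abs_sub_le (h₁ : IsPlaySol T r₁ q ξ₁ ξ₁') (h₂ : IsPlaySol T r₂ q ξ₂ ξ₂') {t : ℝ}
    (ht : t ∈ Icc 0 T) : |ξ₁ t - ξ₂ t| ≤ |r₁ - r₂| := by
  have h := h₂.sub_le h₁ ht
  rw [abs_sub_comm r₂ r₁] at h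
  exact abs_le.mpr ⟨by linarith, h₁.sub_le h₂ ht⟩

end IsPlaySol

/-- Integration by parts for the energy density of a Lipschitz function. -/
lemma integral_mul_deriv_of_lipschitz {f f' : ℝ → ℝ} {K : NNReal} (hf : LipschitzWith K f)
    (hf' : ∀ᵐ v : ℝ, HasDerivAt f (f' v) v) (v : ℝ) :
    ∫ x in (0 : ℝ)..v, x * f' x = v * f v - ∫ x in (0 : ℝ)..v, f x := by
  have h1 : ∫ x in (0 : ℝ)..v, x * f' x = ∫ x in (0 : ℝ)..v, x * deriv f x := by
    refine intervalIntegral.integral_congr_ae ?_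
    filter_upwards [hf'] with x hx _
    rw [hx.deriv]
  have hid : AbsolutelyContinuousOnInterval (fun x : ℝ ↦ x) 0 v :=
    LipschitzOnWith.absolutelyContinuousOnInterval (K := 1) LipschitzWith.id.lipschitzOnWith
  rw [h1, hid.integral_mul_deriv_eq_deriv_mul
    (hf.lipschitzOnWith.absolutelyContinuousOnInterval)]
  simp

/-- The energy density `v ↦ v f(v) - ∫₀^v f` of a monotone function `f` satisfies a one-sided
Stieltjes bound, for either order of the endpoints. -/
lemma Monotone.energy_sub_le {f : ℝ → ℝ} (hf : Monotone f) (a b : ℝ) :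
    (b * f b - ∫ x in (0 : ℝ)..b, f x) - (a * f a - ∫ x in (0 : ℝ)..a, f x)
      ≤ b * (f b - f a) := by
  have hi : ∀ x y, IntervalIntegrable f volume x y := fun x y ↦ hf.intervalIntegrable
  have hsub := intervalIntegral.integral_interval_sub_left (hi 0 b) (hi 0 a)
  have hge : (b - a) * f a ≤ ∫ x in a..b, f x := by
    rcases le_total a b with hab | hab
    · have := intervalIntegral.integral_mono_on hab (intervalIntegrable_const (c := f a)) (hi a b)
        fun x hx ↦ hf hx.1
      simpa using this
    · have := intervalIntegral.integral_mono_on hab (hi b a) (intervalIntegrable_const (c := f a))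
        fun x hx ↦ hf hx.2
      rw [intervalIntegral.integral_symm]
      simp only [intervalIntegral.integral_const, smul_eq_mul] at this
      linarith
  linarith

lemma AbsolutelyContinuousOnInterval.of_abs_sub_le {f W : ℝ → ℝ} {a b C : ℝ}
    (hW : AbsolutelyContinuousOnInterval W a b)
    (h : ∀ x ∈ uIcc a b, ∀ y ∈ uIcc a b, |f x - f y| ≤ C * |W x - W y|) :
    AbsolutelyContinuousOnInterval f a b := by
  have hlim : Filter.Tendsto _ _ _ := Filter.Tendsto.const_mul C hW
  rw [mul_zero] at hlim
  refine squeeze_zero' (Filter.Eventually.of_forall fun E ↦ Finset.sum_nonneg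
    fun i _ ↦ dist_nonneg) ?_ hlim
  refine Filter.eventually_inf_principal.mpr (Filter.Eventually.of_forall fun E hE ↦ ?_)
  rw [Finset.mul_sum]
  exact Finset.sum_le_sum fun i hi ↦ h _ (hE.1 i hi).1 _ (hE.1 i hi).2

lemma AbsolutelyContinuousOnInterval.isACOn {T : ℝ} {f : ℝ → ℝ} (hT : 0 ≤ T)
    (hf : AbsolutelyContinuousOnInterval f 0 T) : IsACOn T f (deriv f) := by
  refine ⟨?_, fun t ht ↦ ?_⟩
  · rw [integrableOn_Icc_iff_integrableOn_Ioc,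
      ← intervalIntegrable_iff_integrableOn_Ioc_of_le hT]
    exact hf.intervalIntegrable_deriv
  · rw [(hf.mono (uIcc_subset_uIcc_left (by rwa [uIcc_of_le hT]))).integral_deriv_eq_sub]
    ring

lemma HasDerivAt.nonneg_of_right_nonneg {f : ℝ → ℝ} {f' s T : ℝ} (hf : HasDerivAt f f' s)
    (hsT : s < T) (hs : f s = 0) (h : ∀ t ∈ Ioo s T, 0 ≤ f t) : 0 ≤ f' := by
  have hlim := (hasDerivWithinAt_iff_tendsto_slope' (notMem_Ioi.mpr le_rfl)).mp
    (hf.hasDerivWithinAt (s := Ioi s))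
  refine ge_of_tendsto hlim ?_
  filter_upwards [Ioo_mem_nhdsGT hsT] with t ht
  rw [slope_def_field, hs, sub_zero]
  exact div_nonneg (h t ht) (sub_nonneg.mpr ht.1.le)

/-- Bounds propagated from the initial state of a play with threshold `r` keep it within the
range of its input. -/
lemma abs_le_of_play_bounds {x p r w w' : ℝ} (hr : 0 < r) (hw : 0 ≤ w) (hw' : w ≤ w')
    (hup : x ≤ max (max (p - r) (min 0 (p + r))) (p + w - r))
    (hlo : min (max (p - r) (min 0 (p + r))) (p - w + r) ≤ x) : |x| ≤ |p| + w' := by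
  have h1 := neg_abs_le p
  have h2 := le_abs_self p
  have h3 : max (p - r) (min 0 (p + r)) ≤ |p| :=
    max_le (by linarith) ((min_le_left _ _).trans (abs_nonneg p))
  have h4 : -|p| ≤ max (p - r) (min 0 (p + r)) :=
    le_max_of_le_right (le_min (by linarith [abs_nonneg p]) (by linarith))
  rw [abs_le]
  constructor
  · exact le_trans (le_min (by linarith) (by linarith)) hlo
  · exact hup.trans (max_le (by linarith) (by linarith))

lemma aestronglyMeasurable_energy {g : ℝ → ℝ → ℝ} {ν : Measure ℝ} {η : ℝ → ℝ}
    (hg : Measurable (Function.uncurry g)) (hη : AEMeasurable η ν) :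
    AEStronglyMeasurable (fun ρ ↦ η ρ * g ρ (η ρ) - ∫ x in (0 : ℝ)..η ρ, g ρ x) ν := by
  obtain ⟨ζ, hζm, hζ⟩ := hη
  have h1 : Measurable fun z : ℝ × ℝ ↦ g z.1 (ζ z.1 * z.2) :=
    hg.comp (measurable_fst.prodMk ((hζm.comp measurable_fst).mul measurable_snd))
  have h2 : StronglyMeasurable fun ρ ↦ ∫ x in Ioc (0 : ℝ) 1, g ρ (ζ ρ * x) :=
    h1.stronglyMeasurable.integral_prod_right'
  have h3 : Measurable fun ρ ↦ g ρ (ζ ρ) := hg.comp (measurable_id.prodMk hζm)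
  refine ((hζm.mul h3).sub (hζm.mul h2.measurable)).aestronglyMeasurable.congr ?_
  filter_upwards [hζ] with ρ h4
  have h5 := intervalIntegral.mul_integral_comp_mul_left (a := 0) (b := 1) (f := g ρ) (ζ ρ)
  rw [intervalIntegral.integral_of_le zero_le_one] at h5
  simp only [mul_zero, mul_one] at h5
  simp only [Pi.sub_apply, Pi.mul_apply]
  rw [h4, h5]

/-- The estimates on the increments of a play solution and of the densities evaluated along it
that are needed for the energy inequality; here `e` is the energy density of `f`. -/
lemma preisach_increment_bounds {f : ℝ → ℝ} {m R w r p a b : ℝ} (hm : 0 ≤ m) (hr : 0 < r)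
    (hw : 0 ≤ w) (hf : Monotone f) (hL : LipschitzWith (Real.toNNReal m) f) {e : ℝ → ℝ}
    (he : ∀ v, e v = v * f v - ∫ x in (0 : ℝ)..v, f x)
    (ha : |a| ≤ R) (hb : |b| ≤ R) (hpa : |p - a| ≤ r)
    (hup : b ≤ max a (p + w - r)) (hlo : min a (p - w + r) ≤ b) :
    |f b - f a| ≤ m * w ∧ |e b - e a| ≤ R * m * w ∧
      -(m * w ^ 2) ≤ p * (f b - f a) - (e b - e a) := by
  have hR : 0 ≤ R := (abs_nonneg a).trans ha
  have hab := hf.energy_sub_le a b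
  have hba := hf.energy_sub_le b a
  rw [← he, ← he] at hab hba
  have hdist := hL.dist_le_mul b a
  rw [Real.dist_eq, Real.dist_eq, Real.coe_toNNReal m hm] at hdist
  rw [abs_le] at ha hb hpa
  have hmw := mul_nonneg hm hw
  have hinc : |b - a| ≤ w := by
    rw [abs_le]; constructor <;> grind
  have hfw : |f b - f a| ≤ m * w := hdist.trans (mul_le_mul_of_nonneg_left hinc hm)
  refine ⟨hfw, ?_, ?_⟩
  · have hprod : ∀ c, |c| ≤ R → |c * (f b - f a)| ≤ R * m * w := by
      intro c hc
      rw [abs_mul, mul_assoc]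
      exact mul_le_mul hc hfw (abs_nonneg _) hR
    have h1 := abs_le.mp (hprod b (abs_le.mpr hb))
    have h2 := abs_le.mp (hprod a (abs_le.mpr ha))
    rw [abs_le]
    constructor <;> linarith
  · have hkey : -(m * w ^ 2) ≤ (p - b) * (f b - f a) := by
      have hfw' := abs_le.mp hfw
      rcases lt_trichotomy a b with h | h | h
      · have h1 := hf h.le
        have h2 : -w ≤ p - b := by grind
        nlinarith
      · subst h
        simp only [sub_self, mul_zero]
        nlinarith
      · have h1 := hf h.le
        have h2 : p - b ≤ w := by grind
        nlinarith
    linarith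

/-- Energy inequality for the Preisach operator `P` with hysteresis potential `U`:
`P` and `U` are absolutely continuous and `q·(d/dt)P[q] - (d/dt)U[q] ≥ 0` a.e.,
where `U` is built from `G(r,v) = ∫₀^v v'·∂g/∂v(r,v') dv'`. -/
theorem stmt_6 (T : ℝ) (hT : 0 < T)
    (g : ℝ → ℝ → ℝ) (μ : ℝ → ℝ) (hg : IsPreisachDensity g μ)
    -- gv is the a.e. partial derivative ∂g/∂v (it exists a.e. since g(r,·) is Lipschitz)
    (gv : ℝ → ℝ → ℝ)
    (hgv : ∀ᵐ ρ ∂(volume.restrict (Ioi (0:ℝ))),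
      ∀ᵐ v : ℝ, HasDerivAt (g ρ) (gv ρ v) v)
    (G : ℝ → ℝ → ℝ) (hG : ∀ ρ v, G ρ v = ∫ v' in (0:ℝ)..v, v' * gv ρ v')
    (q q' : ℝ → ℝ) (hq : IsACOn T q q')
    (ξ : ℝ → ℝ → ℝ) (hξ : ∀ ρ : ℝ, 0 < ρ → ∃ d, IsPlaySol T ρ q (ξ ρ) d)
    (P U : ℝ → ℝ)
    (hP : ∀ t, P t = ∫ ρ in Ioi (0:ℝ), g ρ (ξ ρ t))
    (hU : ∀ t, U t = ∫ ρ in Ioi (0:ℝ), G ρ (ξ ρ t)) :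
    ∃ P' U' : ℝ → ℝ, IsACOn T P P' ∧ IsACOn T U U' ∧
      ∀ᵐ t ∂(volume.restrict (Ioo 0 T)), q t * P' t - U' t ≥ 0 := by
  obtain ⟨hgm, hμ, hgae⟩ := hg
  have h0T : (0 : ℝ) ∈ Icc 0 T := ⟨le_rfl, hT.le⟩
  choose d hd using hξ
  set W : ℝ → ℝ := fun t ↦ ∫ τ in (0 : ℝ)..t, |q' τ| with hW
  have hWac : IsACOn T W fun τ ↦ |q' τ| := ⟨hq.1.abs, fun t _ ↦ by simp [hW]⟩
  have hWmono : ∀ s t, 0 ≤ s → s ≤ t → t ≤ T → W s ≤ W t := by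
    intro s t hs hst ht
    rw [← sub_nonneg, hWac.sub_eq_integral ⟨hs, hst.trans ht⟩ ⟨hs.trans hst, ht⟩]
    exact intervalIntegral.integral_nonneg hst fun _ _ ↦ abs_nonneg _
  have hqW : ∀ s t, 0 ≤ s → s ≤ t → t ≤ T → |q t - q s| ≤ W t - W s := by
    intro s t hs hst ht
    rw [hq.sub_eq_integral ⟨hs, hst.trans ht⟩ ⟨hs.trans hst, ht⟩,
      hWac.sub_eq_integral ⟨hs, hst.trans ht⟩ ⟨hs.trans hst, ht⟩]
    exact intervalIntegral.abs_integral_le_integral_abs hst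
  have hup : ∀ ρ, 0 < ρ → ∀ s t, 0 ≤ s → s ≤ t → t ≤ T →
      ξ ρ t ≤ max (ξ ρ s) (q s + (W t - W s) - ρ) := by
    intro ρ hρ s t hs hst ht
    refine (hd ρ hρ).le_max hs hst ht fun τ hτ ↦ ?_
    have h1 := abs_le.mp (hqW s τ hs hτ.1 (hτ.2.trans ht))
    have h2 := hWmono τ t (hs.trans hτ.1) hτ.2 ht
    linarith
  have hlo : ∀ ρ, 0 < ρ → ∀ s t, 0 ≤ s → s ≤ t → t ≤ T →
      min (ξ ρ s) (q s - (W t - W s) + ρ) ≤ ξ ρ t := by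
    intro ρ hρ s t hs hst ht
    refine (hd ρ hρ).min_le hs hst ht fun τ hτ ↦ ?_
    have h1 := abs_le.mp (hqW s τ hs hτ.1 (hτ.2.trans ht))
    have h2 := hWmono τ t (hs.trans hτ.1) hτ.2 ht
    linarith
  set R : ℝ := |q 0| + W T
  have hξR : ∀ ρ, 0 < ρ → ∀ t ∈ Icc 0 T, |ξ ρ t| ≤ R := by
    intro ρ hρ t ht
    have h1 := hup ρ hρ 0 t le_rfl ht.1 ht.2
    have h2 := hlo ρ hρ 0 t le_rfl ht.1 ht.2
    have h3 := hWmono 0 t le_rfl ht.1 ht.2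
    have h4 := hWmono t T ht.1 ht.2 le_rfl
    have h5 : W 0 = 0 := by simp [hW]
    rw [(hd ρ hρ).2.2.2, h5, sub_zero] at h1 h2
    exact abs_le_of_play_bounds hρ (h5 ▸ h3) h4 h1 h2
  have hGe : ∀ᵐ ρ ∂(volume.restrict (Ioi (0 : ℝ))), ∀ v,
      G ρ v = v * g ρ v - ∫ x in (0 : ℝ)..v, g ρ x := by
    filter_upwards [hgae, hgv] with ρ h1 h2 v
    rw [hG, integral_mul_deriv_of_lipschitz h1.2.2.2 h2]
  have hbound : ∀ s t, 0 ≤ s → s ≤ t → t ≤ T → ∀ᵐ ρ ∂(volume.restrict (Ioi (0 : ℝ))),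
      |g ρ (ξ ρ t) - g ρ (ξ ρ s)| ≤ μ ρ * (W t - W s) ∧
      |G ρ (ξ ρ t) - G ρ (ξ ρ s)| ≤ R * μ ρ * (W t - W s) ∧
      -(μ ρ * (W t - W s) ^ 2) ≤
        q s * (g ρ (ξ ρ t) - g ρ (ξ ρ s)) - (G ρ (ξ ρ t) - G ρ (ξ ρ s)) := by
    intro s t hs hst ht
    filter_upwards [hgae, hGe, ae_restrict_mem measurableSet_Ioi] with ρ h1 h2 hρ
    have hsI : s ∈ Icc 0 T := ⟨hs, hst.trans ht⟩
    exact preisach_increment_bounds h1.2.1 hρ (sub_nonneg.mpr (hWmono s t hs hst ht)) h1.2.2.1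
      h1.2.2.2 h2 (hξR ρ hρ s hsI) (hξR ρ hρ t ⟨hs.trans hst, ht⟩) ((hd ρ hρ).2.1 s hsI)
      (hup ρ hρ s t hs hst ht) (hlo ρ hρ s t hs hst ht)
  have hξm : ∀ t ∈ Icc 0 T, AEMeasurable (fun ρ ↦ ξ ρ t) (volume.restrict (Ioi (0 : ℝ))) := by
    intro t ht
    have hlip : LipschitzOnWith 1 (fun ρ ↦ ξ ρ t) (Ioi 0) :=
      LipschitzOnWith.of_dist_le_mul fun ρ₁ h₁ ρ₂ h₂ ↦ by
        simpa [Real.dist_eq] using (hd ρ₁ h₁).abs_sub_le (hd ρ₂ h₂) ht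
    exact hlip.continuousOn.aemeasurable measurableSet_Ioi
  have hPm : ∀ t ∈ Icc 0 T, AEStronglyMeasurable (fun ρ ↦ g ρ (ξ ρ t))
      (volume.restrict (Ioi (0 : ℝ))) := fun t ht ↦
    (hgm.comp_aemeasurable (aemeasurable_id.prodMk (hξm t ht))).aestronglyMeasurable
  have hUm : ∀ t ∈ Icc 0 T, AEStronglyMeasurable (fun ρ ↦ G ρ (ξ ρ t))
      (volume.restrict (Ioi (0 : ℝ))) := by
    intro t ht
    refine (aestronglyMeasurable_energy hgm (hξm t ht)).congr ?_
    filter_upwards [hGe] with ρ h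
    rw [h]
  have hPi : ∀ t ∈ Icc 0 T, IntegrableOn (fun ρ ↦ g ρ (ξ ρ t)) (Ioi 0) := by
    intro t ht
    refine (hμ.mul_const R).mono' (hPm t ht) ?_
    filter_upwards [hgae, ae_restrict_mem measurableSet_Ioi] with ρ h1 hρ
    have h2 := h1.2.2.2.dist_le_mul (ξ ρ t) 0
    rw [Real.dist_eq, Real.dist_eq, Real.coe_toNNReal _ h1.2.1, h1.1, sub_zero, sub_zero] at h2
    exact h2.trans (mul_le_mul_of_nonneg_left (hξR ρ hρ t ht) h1.2.1)
  have hUi : ∀ t ∈ Icc 0 T, IntegrableOn (fun ρ ↦ G ρ (ξ ρ t)) (Ioi 0) := by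
    intro t ht
    refine (hμ.mul_const (R * R)).mono' (hUm t ht) ?_
    filter_upwards [hgae, hGe, ae_restrict_mem measurableSet_Ioi] with ρ h1 h2 hρ
    have h3 := h1.2.2.1.energy_sub_le 0 (ξ ρ t)
    have h4 := h1.2.2.1.energy_sub_le (ξ ρ t) 0
    have h5 := h1.2.2.2.dist_le_mul (ξ ρ t) 0
    rw [Real.dist_eq, Real.dist_eq, Real.coe_toNNReal _ h1.2.1, h1.1, sub_zero, sub_zero] at h5
    rw [← h2, ← h2, h1.1] at h3 h4
    have h6 := hξR ρ hρ t ht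
    have h7 : |ξ ρ t * g ρ (ξ ρ t)| ≤ μ ρ * (R * R) := by
      rw [abs_mul, mul_comm, ← mul_assoc]
      exact mul_le_mul (h5.trans (mul_le_mul_of_nonneg_left h6 h1.2.1)) h6 (abs_nonneg _)
        (mul_nonneg h1.2.1 ((abs_nonneg _).trans h6))
    have h8 : G ρ 0 = 0 := by simp [hG]
    rw [abs_le] at h7
    rw [Real.norm_eq_abs, abs_le]
    constructor <;> linarith
  set M : ℝ := ∫ ρ in Ioi (0 : ℝ), μ ρ with hM
  have hPsub : ∀ s ∈ Icc 0 T, ∀ t ∈ Icc 0 T,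
      P t - P s = ∫ ρ in Ioi (0 : ℝ), (g ρ (ξ ρ t) - g ρ (ξ ρ s)) := fun s hs t ht ↦ by
    rw [integral_sub (hPi t ht) (hPi s hs), hP, hP]
  have hUsub : ∀ s ∈ Icc 0 T, ∀ t ∈ Icc 0 T,
      U t - U s = ∫ ρ in Ioi (0 : ℝ), (G ρ (ξ ρ t) - G ρ (ξ ρ s)) := fun s hs t ht ↦ by
    rw [integral_sub (hUi t ht) (hUi s hs), hU, hU]
  have hPW : ∀ s t, 0 ≤ s → s ≤ t → t ≤ T → |P t - P s| ≤ M * (W t - W s) := by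
    intro s t hs hst ht
    rw [hPsub s ⟨hs, hst.trans ht⟩ t ⟨hs.trans hst, ht⟩, hM, ← integral_mul_const,
      ← Real.norm_eq_abs]
    refine norm_integral_le_of_norm_le (hμ.mul_const _) ?_
    exact (hbound s t hs hst ht).mono fun ρ h ↦ h.1
  have hUW : ∀ s t, 0 ≤ s → s ≤ t → t ≤ T → |U t - U s| ≤ R * M * (W t - W s) := by
    intro s t hs hst ht
    rw [hUsub s ⟨hs, hst.trans ht⟩ t ⟨hs.trans hst, ht⟩, hM, ← integral_const_mul,
      ← integral_mul_const, ← Real.norm_eq_abs]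
    refine norm_integral_le_of_norm_le ((hμ.const_mul _).mul_const _) ?_
    exact (hbound s t hs hst ht).mono fun ρ h ↦ h.2.1
  have henergy : ∀ s t, 0 ≤ s → s ≤ t → t ≤ T →
      0 ≤ q s * (P t - P s) - (U t - U s) + M * (W t - W s) ^ 2 := by
    intro s t hs hst ht
    have hsI : s ∈ Icc 0 T := ⟨hs, hst.trans ht⟩
    have htI : t ∈ Icc 0 T := ⟨hs.trans hst, ht⟩
    have hgi : IntegrableOn (fun ρ ↦ q s * (g ρ (ξ ρ t) - g ρ (ξ ρ s))) (Ioi 0) :=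
      ((hPi t htI).sub (hPi s hsI)).const_mul (q s)
    have hGi : IntegrableOn (fun ρ ↦ G ρ (ξ ρ t) - G ρ (ξ ρ s)) (Ioi 0) :=
      (hUi t htI).sub (hUi s hsI)
    have hle := integral_mono_ae (hμ.mul_const ((W t - W s) ^ 2)).neg (hgi.sub hGi)
      ((hbound s t hs hst ht).mono fun ρ h ↦ h.2.2)
    simp only [Pi.neg_apply, Pi.sub_apply] at hle
    rw [integral_neg, integral_mul_const] at hle
    rw [hPsub s hsI t htI, hUsub s hsI t htI, ← integral_const_mul, ← integral_sub hgi hGi]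
    linarith
  have hWabs : AbsolutelyContinuousOnInterval W 0 T :=
    (hWac.intervalIntegrable h0T ⟨hT.le, le_rfl⟩).absolutelyContinuousOnInterval_intervalIntegral
      left_mem_uIcc
  have hac : ∀ (f : ℝ → ℝ) (C : ℝ),
      (∀ s t, 0 ≤ s → s ≤ t → t ≤ T → |f t - f s| ≤ C * (W t - W s)) →
      AbsolutelyContinuousOnInterval f 0 T := by
    intro f C hf
    refine hWabs.of_abs_sub_le (C := C) ?_
    rw [uIcc_of_le hT.le]
    intro x hx y hy
    rcases le_total x y with hxy | hxy
    · rw [abs_sub_comm, abs_sub_comm (W x),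
        abs_of_nonneg (sub_nonneg.mpr (hWmono x y hx.1 hxy hy.2))]
      exact hf x y hx.1 hxy hy.2
    · rw [abs_of_nonneg (sub_nonneg.mpr (hWmono y x hy.1 hxy hx.2))]
      exact hf y x hy.1 hxy hx.2
  have hPac := hac P M hPW
  have hUac := hac U (R * M) hUW
  refine ⟨deriv P, deriv U, hPac.isACOn hT.le, hUac.isACOn hT.le, ?_⟩
  filter_upwards [ae_restrict_of_ae hPac.ae_differentiableAt,
    ae_restrict_of_ae hUac.ae_differentiableAt, ae_restrict_of_ae hWabs.ae_differentiableAt,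
    ae_restrict_mem measurableSet_Ioo] with s hPs hUs hWs hs
  have hsI : s ∈ uIcc 0 T := by rw [uIcc_of_le hT.le]; exact Ioo_subset_Icc_self hs
  have hderiv := ((((hPs hsI).hasDerivAt.sub_const (P s)).const_mul (q s)).sub
    ((hUs hsI).hasDerivAt.sub_const (U s))).add
    ((((hWs hsI).hasDerivAt.sub_const (W s)).pow 2).const_mul M)
  have hnonneg := hderiv.nonneg_of_right_nonneg hs.2 (by simp)
    fun t ht ↦ henergy s t hs.1.le ht.1.le ht.2.le
  simpa using hnonneg
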